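/- For every formula F of nPC and every i ∈ {1,…,n}, the sequent F ⊢_i F is provable in nPC. -/

import Mathlib

/-- Formulas of the n-dimensional propositional calculus nPC:
decorated variables `X^π`, constants `e_k`, and compounds `q(F,G_1,…,G_n)`.
Dimensions are elements of `Fin n`; propositional variables are natural numbers. -/
inductive Fm (n : ℕ) : Type where
  | var (X : ℕ) (π : Equiv.Perm (Fin n)) : Fm n
  | const (k : Fin n) : Fm n
  | q (F : Fm n) (G : Fin n → Fm n) : Fm n

/-- The action `F^ρ` of a permutation `ρ` on a formula. -/
def Fm.act {n : ℕ} (ρ : Equiv.Perm (Fin n)) : Fm n → Fm n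
  | .var X π => .var X (ρ * π)
  | .const k => .const (ρ k)
  | .q F G => .q F (fun j => (G j).act ρ)

/-- The action of a permutation on a multiset of formulas (context). -/
def actM {n : ℕ} (ρ : Equiv.Perm (Fin n)) (Γ : Multiset (Fm n)) : Multiset (Fm n) :=
  Γ.map (Fm.act ρ)

/-- The sequent calculus of nPC: `Proves Γ i Δ` means the sequent `Γ ⊢_i Δ` is provable. -/
inductive Proves {n : ℕ} : Multiset (Fm n) → Fin n → Multiset (Fm n) → Prop where
  | const (i : Fin n) : Proves 0 i {Fm.const i}
  | id (X : ℕ) (π ρ : Equiv.Perm (Fin n)) (i : Fin n) (h : π⁻¹ i = ρ⁻¹ i) :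
      Proves {Fm.var X π} i {Fm.var X ρ}
  | sym (Γ Δ : Multiset (Fm n)) (i j : Fin n)
      (h : Proves (actM (Equiv.swap i j) Γ) i (actM (Equiv.swap i j) Δ)) :
      Proves Γ j Δ
  | neg1 (Γ Δ : Multiset (Fm n)) (F : Fm n) (i j k : Fin n) (hik : i ≠ k)
      (h : Proves (actM (Equiv.swap i j) Γ) i (F ::ₘ actM (Equiv.swap i j) Δ)) :
      Proves (F.act (Equiv.swap j k) ::ₘ Γ) j Δ
  | neg2 (Γ Δ : Multiset (Fm n)) (F : Fm n) (i j k : Fin n) (hjk : j ≠ k)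
      (h : Proves (actM (Equiv.swap i j) Γ) i (F ::ₘ actM (Equiv.swap i j) Δ)) :
      Proves (F.act (Equiv.swap i k) ::ₘ Γ) j Δ
  | neg3 (Γ Δ : Multiset (Fm n)) (F : Fm n) (j : Fin n)
      (h : ∀ i : Fin n, i ≠ j →
        Proves (F ::ₘ actM (Equiv.swap i j) Γ) i (actM (Equiv.swap i j) Δ)) :
      Proves Γ j (F ::ₘ Δ)
  | qL (Γ Δ : Multiset (Fm n)) (F : Fm n) (G : Fin n → Fm n) (i : Fin n)
      (h : ∀ j : Fin n,
        Proves ((G j).act (Equiv.swap j i) ::ₘ F ::ₘ actM (Equiv.swap j i) Γ) j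
          (actM (Equiv.swap j i) Δ)) :
      Proves (Fm.q F G ::ₘ Γ) i Δ
  | qR (Γ Δ : Multiset (Fm n)) (F : Fm n) (G : Fin n → Fm n) (i : Fin n)
      (h : ∀ j : Fin n,
        Proves (F ::ₘ actM (Equiv.swap j i) Γ) j
          ((G j).act (Equiv.swap j i) ::ₘ actM (Equiv.swap j i) Δ)) :
      Proves Γ i (Fm.q F G ::ₘ Δ)
  | cut (Γ Δ : Multiset (Fm n)) (F : Fm n) (i : Fin n)
      (h1 : Proves (F ::ₘ Γ) i Δ) (h2 : Proves Γ i (F ::ₘ Δ)) : Proves Γ i Δ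
  | weakL (Γ Δ : Multiset (Fm n)) (F : Fm n) (i : Fin n)
      (h : Proves Γ i Δ) : Proves (F ::ₘ Γ) i Δ
  | weakR (Γ Δ : Multiset (Fm n)) (F : Fm n) (i : Fin n)
      (h : Proves Γ i Δ) : Proves Γ i (F ::ₘ Δ)
  | conL (Γ Δ : Multiset (Fm n)) (F : Fm n) (i : Fin n)
      (h : Proves (F ::ₘ F ::ₘ Γ) i Δ) : Proves (F ::ₘ Γ) i Δ
  | conR (Γ Δ : Multiset (Fm n)) (F : Fm n) (i : Fin n)
      (h : Proves Γ i (F ::ₘ F ::ₘ Δ)) : Proves Γ i (F ::ₘ Δ)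

/-- The semantics `⟦F⟧v` of a formula in an environment `v`. -/
def Fm.sem {n : ℕ} (v : ℕ → Fin n) : Fm n → Fin n
  | .var X π => π (v X)
  | .const k => k
  | .q F G => (G (F.sem v)).sem v

/-- `Γ ⊨_i Δ`: every environment making all of `Γ` equal `i` makes some formula of `Δ` equal `i`. -/
def Models {n : ℕ} (Γ : Multiset (Fm n)) (i : Fin n) (Δ : Multiset (Fm n)) : Prop :=
  ∀ v : ℕ → Fin n, (∀ G ∈ Γ, Fm.sem v G = i) → ∃ F ∈ Δ, Fm.sem v F = i

/-- Logical equivalence `F ∼ G`: both `F ⊢_i G` and `G ⊢_i F` are provable for every `i`. -/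
def Eqv {n : ℕ} (F G : Fm n) : Prop :=
  ∀ i : Fin n, Proves {F} i {G} ∧ Proves {G} i {F}

/-- Provability from a (possibly infinite) set of hypotheses:
some finite sub-multiset of `Γ` proves `Δ` at `i`. -/
def ProvesSet {n : ℕ} (Γ : Set (Fm n)) (i : Fin n) (Δ : Multiset (Fm n)) : Prop :=
  ∃ Γ' : Multiset (Fm n), (∀ G ∈ Γ', G ∈ Γ) ∧ Proves Γ' i Δ

/-- `Γ ⊨_i F` for a set `Γ` of hypotheses. -/
def ModelsSet {n : ℕ} (Γ : Set (Fm n)) (i : Fin n) (F : Fm n) : Prop :=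
  ∀ v : ℕ → Fin n, (∀ G ∈ Γ, Fm.sem v G = i) → Fm.sem v F = i

theorem Fm.act_act {n : ℕ} (ρ σ : Equiv.Perm (Fin n)) (F : Fm n) :
    (F.act σ).act ρ = F.act (ρ * σ) := by
  induction F with
  | var X π => simp [Fm.act, mul_assoc]
  | const k => simp [Fm.act]
  | q F G _ ihG => simp [Fm.act, ihG]

theorem Fm.act_one {n : ℕ} (F : Fm n) : F.act 1 = F := by
  induction F with
  | var X π => simp [Fm.act]
  | const k => simp [Fm.act]
  | q F G _ ihG => simp [Fm.act, ihG]

theorem actM_one {n : ℕ} (Γ : Multiset (Fm n)) : actM 1 Γ = Γ := by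
  simp [actM, Fm.act_one]

/-- The instance of the second negation rule in which the turnstile is unchanged. -/
theorem Proves.neg_same {n : ℕ} {Γ Δ : Multiset (Fm n)} {F : Fm n} {j k : Fin n} (hjk : j ≠ k)
    (h : Proves Γ j (F ::ₘ Δ)) : Proves (F.act (Equiv.swap j k) ::ₘ Γ) j Δ :=
  .neg2 Γ Δ F j j k hjk (by simpa [← Equiv.Perm.one_def, actM_one] using h)

theorem Proves.const_self {n : ℕ} (k i : Fin n) :
    Proves {Fm.const k} i {Fm.const k} := by
  by_cases hik : i = k
  · subst hik
    exact .weakL 0 _ _ _ (.const i)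
  · have h : Proves {Fm.const k} i 0 := by
      simpa [Fm.act] using Proves.neg_same (Δ := 0) hik (Proves.const i)
    exact .weakR _ 0 _ _ h

theorem Proves.q_self {n : ℕ} {F : Fm n} {G : Fin n → Fm n}
    (hF : ∀ i, Proves {F} i {F})
    (hG : ∀ (j : Fin n) (σ : Equiv.Perm (Fin n)) (i : Fin n),
      Proves {(G j).act σ} i {(G j).act σ}) (i : Fin n) :
    Proves {Fm.q F G} i {Fm.q F G} := by
  refine .qR _ 0 F G i fun j => ?_
  rw [show actM (Equiv.swap j i) {Fm.q F G}
    = {Fm.q F fun l => (G l).act (Equiv.swap j i)} from rfl, ← Multiset.cons_zero,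
    Multiset.cons_swap]
  refine .qL _ _ F _ j fun k => ?_
  by_cases hkj : k = j
  · subst hkj
    rw [Equiv.swap_self, ← Equiv.Perm.one_def, Fm.act_one, actM_one, actM_one,
      Multiset.cons_swap, Multiset.cons_swap _ F]
    exact .weakL _ _ _ _ (.weakL _ _ _ _ (hG k _ k))
  · have h : Proves (F ::ₘ {F.act (Equiv.swap k j)}) k 0 := by
      rw [← Multiset.cons_zero, Multiset.cons_swap]
      exact .neg_same hkj (hF k)
    exact .weakL _ _ _ _ (.weakR _ 0 _ _ h)

/-- Every formula in the orbit of `F` proves itself. -/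
theorem Proves.act_self {n : ℕ} (F : Fm n) (ρ : Equiv.Perm (Fin n)) (i : Fin n) :
    Proves {F.act ρ} i {F.act ρ} := by
  induction F generalizing ρ i with
  | var X π => exact .id X _ _ i rfl
  | const k => exact .const_self _ i
  | q F G ihF ihG =>
    refine .q_self (fun i => by simpa [Fm.act_one] using ihF 1 i) (fun j σ i => ?_) i
    rw [Fm.act_act]
    exact ihG j _ i

/-- For every nPC formula `F` and every `i`, the sequent `F ⊢_i F` is provable. -/
theorem identity_sequent_provable (n : ℕ) (hn : 2 ≤ n) (F : Fm n) (i : Fin n) :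
    Proves {F} i {F} := by
  simpa [Fm.act_one] using Proves.act_self F 1 i
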